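/- arXiv:1102.2957 — 3 statements merged into one kernel-verified Lean document; each statement's English description precedes it below -/
import Mathlib

section
/- Let φ: S → R be a ring morphism, t = (t₁,…,tₙ) a quasi-regular sequence in R such that R/tR is a finitely generated projective S-module, and suppose R admits a flat S-linear connection ∇⁰: R → R⊗_{S[t]}Ω¹_{S[t]/S} which is standard and satisfies Ker(∇⁰) + tR = R. Let ∇ be its degree −1 extension to R⊗_{S[t]}Ω_{S[t]/S}, set τ = δ∇ + ∇δ (invertible in negative degrees by standardness) and H = τ⁻¹∇. Then: (i) (Hδ + δH)(ω) = ω for every homogeneous ω of nonzero degree; (ii) (1 − δH)(tR) = 0 in degree zero; (iii) H² = 0; (iv) there is a unique S-linear map σ: R/tR → R with δH + σπ = 1 (π: R → R/tR the projection), and this σ satisfies ∇⁰σ = 0. Consequently (π, σ, −H) is a deformation retract datum of ℤ-graded complexes over S contracting the Koszul complex K(t) = (R⊗_{S[t]}Ω_{S[t]/S}, δ) onto R/tR, with H² = 0, Hσ = 0 and πH = 0. -/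
/-!
STATEMENT 7 (the de Rham contraction of the Koszul complex).

Conventions.  `S[t] = S[t₁,…,tₙ]` with the `tᵢ` formal variables, mapped to `R` by
`tᵢ ↦ u i`.  `R ⊗_{S[t]} Ω_{S[t]/S}` is modelled as `Finset (Fin n) → R` (component at
`I` is `R·dt_I`); `δ` is the Koszul contraction with `Σᵢ tᵢ(dtᵢ)*`.  An `S`-linear
connection `∇⁰` on `R` over `S[t]` is encoded by its components `∂ j = (dtⱼ)* ∘ ∇⁰`;
the Leibniz rule over `S[t]` is `∂ⱼ(uᵢ r) = uᵢ ∂ⱼ r + δᵢⱼ r` plus `S`-linearity, and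
flatness is pairwise commutation of the `∂ⱼ`.  The operator `δ∇⁰ : R → R` is
`r ↦ Σᵢ uᵢ ∂ᵢ(r)`; standardness says `p·1_R + δ∇⁰` is bijective and identifies `tR`
with `tR` for all `p > 0`, and `Im(δ∇⁰) = tR`.  The map `H = τ⁻¹∇` (with
`τ = δ∇ + ∇δ`, invertible in nonzero exterior degrees) is characterised by `τ∘H = ∇`
together with `H` vanishing into exterior degree `0`.  Quasi-regularity of `u` is the
classical condition (EGA 0.15.1): every homogeneous polynomial `F` of degree `k` over
`R` with `F(u) ∈ (u)^{k+1}` has all its coefficients in `(u)`.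
-/

namespace Stmt7

open Finset

variable {S R : Type*} [CommRing S] [CommRing R] [Algebra S R] {n : ℕ}

/-- Quasi-regularity of a sequence (EGA 0.15.1 / Matsumura §16). -/
def IsQuasiRegular {R : Type*} [CommRing R] {n : ℕ} (u : Fin n → R) : Prop :=
  ∀ (k : ℕ) (F : MvPolynomial (Fin n) R), F.IsHomogeneous k →
    MvPolynomial.eval u F ∈ (Ideal.span (Set.range u)) ^ (k + 1) →
    ∀ m, MvPolynomial.coeff m F ∈ Ideal.span (Set.range u)

/-- `R ⊗_{S[t]} Ω_{S[t]/S}`, with component `R · dt_I` at `I`. -/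
abbrev RΩ (R : Type*) (n : ℕ) := Finset (Fin n) → R

/-- The sign `(-1)^{#{j ∈ I | j < i}}`. -/
def ksign (R : Type*) [CommRing R] {n : ℕ} (i : Fin n) (I : Finset (Fin n)) : R :=
  (-1 : R) ^ (I.filter (fun j => j < i)).card

/-- The Koszul contraction `δ`. -/
def delRΩ (u : Fin n → R) : Module.End R (RΩ R n) :=
  LinearMap.pi fun J =>
    ∑ i : Fin n,
      if i ∈ J then 0
      else (ksign R i J * u i) • LinearMap.proj (insert i J)

/-- The extension `∇` of the connection: `∇(r · dt_I) = Σⱼ ∂ⱼ(r) · dtⱼ ∧ dt_I`. -/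
def nablaRΩ (dd : Fin n → (R →ₗ[S] R)) : RΩ R n →ₗ[S] RΩ R n :=
  LinearMap.pi fun J =>
    ∑ j : Fin n,
      if j ∈ J then ksign R j J • (dd j ∘ₗ LinearMap.proj (J.erase j)) else 0

/-- The degree-zero operator `δ∇⁰ : r ↦ Σᵢ uᵢ·∂ᵢ(r)` on `R`. -/
def delNabla0 (u : Fin n → R) (dd : Fin n → (R →ₗ[S] R)) : R →ₗ[S] R :=
  ∑ i : Fin n, LinearMap.mulLeft S (u i) ∘ₗ dd i

end Stmt7

namespace Stmt7

section deRham

variable {S R : Type*} [CommRing S] [CommRing R] [Algebra S R] {n : ℕ}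

theorem ksign_mul_self (i : Fin n) (I : Finset (Fin n)) : ksign R i I * ksign R i I = 1 := by
  rw [ksign, ← pow_add, Even.neg_one_pow ⟨_, rfl⟩]

theorem ksign_insert_self (i : Fin n) (I : Finset (Fin n)) :
    ksign R i (insert i I) = ksign R i I := by
  simp [ksign, Finset.filter_insert]

theorem ksign_erase_self (i : Fin n) (I : Finset (Fin n)) :
    ksign R i (I.erase i) = ksign R i I := by
  simp [ksign, Finset.filter_erase]

theorem ksign_insert {i j : Fin n} {I : Finset (Fin n)} (hj : j ∉ I) :
    ksign R i (insert j I) = (if j < i then -1 else 1) * ksign R i I := by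
  unfold ksign
  rw [Finset.filter_insert]
  split_ifs with h
  · rw [Finset.card_insert_of_notMem (by simp [hj]), pow_succ]
    ring
  · simp

theorem ksign_erase {i j : Fin n} {I : Finset (Fin n)} (hj : j ∈ I) :
    ksign R i (I.erase j) = (if j < i then -1 else 1) * ksign R i I := by
  conv_rhs => rw [← Finset.insert_erase hj, ksign_insert (Finset.notMem_erase j I)]
  split_ifs <;> simp

theorem map_ksign_mul (d : R →ₗ[S] R) (i : Fin n) (I : Finset (Fin n)) (r : R) :
    d (ksign R i I * r) = ksign R i I * d r := by
  unfold ksign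
  rcases neg_one_pow_eq_or R (I.filter (fun j => j < i)).card with h | h <;> simp [h]

theorem delRΩ_apply (u : Fin n → R) (f : RΩ R n) (J : Finset (Fin n)) :
    delRΩ u f J = ∑ i, if i ∈ J then 0 else ksign R i J * u i * f (insert i J) := by
  simp only [delRΩ, LinearMap.pi_apply, LinearMap.sum_apply]
  refine Finset.sum_congr rfl fun i _ => ?_
  split_ifs <;> simp

theorem delRΩ_apply_empty (u : Fin n → R) (f : RΩ R n) :
    delRΩ u f ∅ = ∑ i, u i * f {i} := by
  simp [delRΩ_apply, ksign]

theorem nablaRΩ_apply (dd : Fin n → (R →ₗ[S] R)) (f : RΩ R n) (J : Finset (Fin n)) :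
    nablaRΩ dd f J = ∑ j, if j ∈ J then ksign R j J * dd j (f (J.erase j)) else 0 := by
  simp only [nablaRΩ, LinearMap.pi_apply, LinearMap.sum_apply]
  refine Finset.sum_congr rfl fun i _ => ?_
  split_ifs <;> simp

theorem nablaRΩ_apply_singleton (dd : Fin n → (R →ₗ[S] R)) (f : RΩ R n) (i : Fin n) :
    nablaRΩ dd f {i} = dd i (f ∅) := by
  rw [nablaRΩ_apply, Finset.sum_eq_single i] <;> simp +contextual [ksign, Finset.filter_singleton]

theorem delNabla0_apply (u : Fin n → R) (dd : Fin n → (R →ₗ[S] R)) (r : R) :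
    delNabla0 u dd r = ∑ i, u i * dd i r := by
  simp [delNabla0]

/-- The Lie derivative `δ∇ + ∇δ` acts on the coefficient of `dt_J` as `|J| + δ∇⁰`. -/
theorem delRΩ_nablaRΩ_add_apply {u : Fin n → R} {dd : Fin n → (R →ₗ[S] R)}
    (hleib : ∀ i j r, dd j (u i * r) = u i * dd j r + (if i = j then r else 0))
    (f : RΩ R n) (J : Finset (Fin n)) :
    delRΩ u (nablaRΩ dd f) J + nablaRΩ dd (delRΩ u f) J =
      (J.card • (LinearMap.id : R →ₗ[S] R) + delNabla0 u dd) (f J) := by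
  have key : ∀ i j : Fin n,
      (if i ∈ J then 0 else ksign R i J * u i * (if j ∈ insert i J then
        ksign R j (insert i J) * dd j (f ((insert i J).erase j)) else 0)) +
      (if j ∈ J then ksign R j J * dd j (if i ∈ J.erase j then 0 else
        ksign R i (J.erase j) * u i * f (insert i (J.erase j))) else 0) =
      if i = j then u i * dd i (f J) + (if i ∈ J then f J else 0) else 0 := by
    intro i j
    by_cases hij : i = j
    · subst hij
      by_cases hi : i ∈ J
      · simp only [hi, Finset.notMem_erase, Finset.insert_erase, if_true, if_false, mul_assoc,
          map_ksign_mul, hleib, ksign_erase_self, zero_add]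
        rw [← mul_assoc, ksign_mul_self, one_mul]
      · simp only [hi, Finset.mem_insert_self, Finset.erase_insert hi, if_true, if_false,
          ksign_insert_self, add_zero]
        linear_combination u i * dd i (f J) * ksign_mul_self (R := R) i J
    · by_cases hi : i ∈ J
      · simp [hi, hij]
      · by_cases hj : j ∈ J
        · have h1 : (insert i J).erase j = insert i (J.erase j) :=
            Finset.erase_insert_of_ne hij
          simp only [hi, hj, hij, Finset.mem_insert, Finset.mem_erase, or_true, and_false,
            if_true, if_false, mul_assoc, map_ksign_mul, hleib, h1, add_zero]
          simp only [ksign_insert hi, ksign_erase hj]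
          rcases lt_or_gt_of_ne hij with h | h <;> simp only [h, h.not_gt, if_true, if_false] <;>
            ring
        · simp [hi, hj, hij, Ne.symm hij]
  rw [delRΩ_apply, nablaRΩ_apply]
  simp only [nablaRΩ_apply, delRΩ_apply, Finset.mul_sum, map_sum]
  have h1 : ∀ i : Fin n, (if i ∈ J then (0 : R) else ∑ j, ksign R i J * u i *
      (if j ∈ insert i J then
        ksign R j (insert i J) * dd j (f ((insert i J).erase j)) else 0)) =
      ∑ j, if i ∈ J then (0 : R) else ksign R i J * u i *
      (if j ∈ insert i J then
        ksign R j (insert i J) * dd j (f ((insert i J).erase j)) else 0) := by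
    intro i; split_ifs <;> simp
  have h2 : ∀ j : Fin n, (if j ∈ J then ∑ i, ksign R j J * dd j (if i ∈ J.erase j then 0 else
        ksign R i (J.erase j) * u i * f (insert i (J.erase j))) else 0) =
      ∑ i, if j ∈ J then ksign R j J * dd j (if i ∈ J.erase j then 0 else
        ksign R i (J.erase j) * u i * f (insert i (J.erase j))) else 0 := by
    intro j; split_ifs <;> simp
  simp only [h1, h2]
  rw [Finset.sum_comm (f := fun j i => if j ∈ J then _ else _), ← Finset.sum_add_distrib]
  simp only [← Finset.sum_add_distrib, key]
  simp [Finset.sum_add_distrib, delNabla0_apply, add_comm]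

theorem sum_sum_eq_zero_of_antisymm {ι M : Type*} [Fintype ι] [AddCommGroup M]
    (F : ι → ι → M) (hF : ∀ i j, F i j + F j i = 0) (hd : ∀ i, F i i = 0) :
    ∑ i, ∑ j, F i j = 0 := by
  rw [← Finset.sum_product']
  refine Finset.sum_involution (fun p _ => p.swap) (fun p _ => hF p.1 p.2) ?_
    (fun _ _ => by simp) (fun _ _ => Prod.swap_swap _)
  rintro ⟨i, j⟩ _ h heq
  obtain rfl : j = i := congrArg Prod.fst heq
  exact h (hd _)

theorem nablaRΩ_nablaRΩ {dd : Fin n → (R →ₗ[S] R)}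
    (hflat : ∀ i j, dd i ∘ₗ dd j = dd j ∘ₗ dd i) (f : RΩ R n) :
    nablaRΩ dd (nablaRΩ dd f) = 0 := by
  funext J
  have h1 : ∀ i : Fin n, (if i ∈ J then ksign R i J * dd i (nablaRΩ dd f (J.erase i)) else 0) =
      ∑ j, if i ∈ J ∧ j ∈ J ∧ i ≠ j then
        ksign R i J * (ksign R j (J.erase i) * dd i (dd j (f ((J.erase i).erase j)))) else 0 := by
    intro i
    rw [nablaRΩ_apply]
    by_cases hi : i ∈ J
    · simp only [hi, if_true, true_and, map_sum, Finset.mul_sum]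
      refine Finset.sum_congr rfl fun j _ => ?_
      by_cases hj : j ∈ J <;> by_cases hij : i = j <;>
        simp [hj, hij, eq_comm (a := j), map_ksign_mul]
    · simp [hi]
  rw [nablaRΩ_apply]
  simp only [h1]
  refine sum_sum_eq_zero_of_antisymm _ (fun i j => ?_) (fun i => by simp)
  by_cases hi : i ∈ J
  · by_cases hj : j ∈ J
    · by_cases hij : i = j
      · simp [hij]
      · have hd : ∀ r, dd i (dd j r) = dd j (dd i r) := LinearMap.congr_fun (hflat i j)
        simp only [hi, hj, hij, Ne.symm hij, ne_eq, not_false_eq_true, and_self, if_true,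
          ksign_erase hi, ksign_erase hj, hd, Finset.erase_right_comm (a := i) (b := j)]
        rcases lt_or_gt_of_ne hij with h | h <;> simp only [h, h.not_gt, if_true, if_false] <;>
          ring
    · simp [hj]
  · simp [hi]

theorem delNabla0_mul {u : Fin n → R} {dd : Fin n → (R →ₗ[S] R)}
    (hleib : ∀ i j r, dd j (u i * r) = u i * dd j r + (if i = j then r else 0))
    (i : Fin n) (r : R) :
    delNabla0 u dd (u i * r) = u i * (r + delNabla0 u dd r) := by
  simp only [delNabla0_apply, hleib, mul_add, Finset.sum_add_distrib, Finset.mul_sum]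
  simp [mul_left_comm, add_comm]

theorem map_delNabla0 {u : Fin n → R} {dd : Fin n → (R →ₗ[S] R)}
    (hleib : ∀ i j r, dd j (u i * r) = u i * dd j r + (if i = j then r else 0))
    (hflat : ∀ i j, dd i ∘ₗ dd j = dd j ∘ₗ dd i) (j : Fin n) (r : R) :
    dd j (delNabla0 u dd r) = dd j r + delNabla0 u dd (dd j r) := by
  have hd : ∀ i r, dd j (dd i r) = dd i (dd j r) := fun i => LinearMap.congr_fun (hflat j i)
  simp only [delNabla0_apply, map_sum, hleib, Finset.sum_add_distrib, hd]
  simp [add_comm]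

/-- `δ` commutes with the Lie derivative. -/
theorem lie_delRΩ_apply {u : Fin n → R} {dd : Fin n → (R →ₗ[S] R)}
    (hleib : ∀ i j r, dd j (u i * r) = u i * dd j r + (if i = j then r else 0))
    (f : RΩ R n) (J : Finset (Fin n)) :
    (J.card • (LinearMap.id : R →ₗ[S] R) + delNabla0 u dd) (delRΩ u f J) =
      delRΩ u (fun K => (K.card • (LinearMap.id : R →ₗ[S] R) + delNabla0 u dd) (f K)) J := by
  rw [delRΩ_apply, delRΩ_apply, map_sum]
  refine Finset.sum_congr rfl fun i _ => ?_
  by_cases hi : i ∈ J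
  · simp [hi]
  · simp only [hi, if_false, mul_assoc, map_ksign_mul, LinearMap.add_apply, LinearMap.smul_apply,
      LinearMap.id_apply, delNabla0_mul hleib, Finset.card_insert_of_notMem hi, add_smul, one_smul]
    simp only [nsmul_eq_mul]
    ring

/-- `∇` commutes with the Lie derivative. -/
theorem lie_nablaRΩ_apply {u : Fin n → R} {dd : Fin n → (R →ₗ[S] R)}
    (hleib : ∀ i j r, dd j (u i * r) = u i * dd j r + (if i = j then r else 0))
    (hflat : ∀ i j, dd i ∘ₗ dd j = dd j ∘ₗ dd i) (f : RΩ R n) (J : Finset (Fin n)) :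
    (J.card • (LinearMap.id : R →ₗ[S] R) + delNabla0 u dd) (nablaRΩ dd f J) =
      nablaRΩ dd (fun K => (K.card • (LinearMap.id : R →ₗ[S] R) + delNabla0 u dd) (f K)) J := by
  rw [nablaRΩ_apply, nablaRΩ_apply, map_sum]
  refine Finset.sum_congr rfl fun i _ => ?_
  by_cases hi : i ∈ J
  · simp only [hi, if_true, map_ksign_mul, LinearMap.add_apply, LinearMap.smul_apply,
      LinearMap.id_apply, map_add, map_nsmul, map_delNabla0 hleib hflat]
    rw [← Finset.card_erase_add_one hi, add_smul, one_smul, nsmul_eq_mul, nsmul_eq_mul]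
    ring
  · simp [hi]

theorem nablaRΩ_eq_zero {dd : Fin n → (R →ₗ[S] R)} {f : RΩ R n} {k : ℕ}
    (hf : ∀ I : Finset (Fin n), I.card ≠ k → f I = 0) {J : Finset (Fin n)} (hJ : J.card ≠ k + 1) :
    nablaRΩ dd f J = 0 := by
  rw [nablaRΩ_apply]
  refine Finset.sum_eq_zero fun j _ => ?_
  split_ifs with hj
  · rw [hf, map_zero, mul_zero]
    intro h
    exact hJ (by rw [← h, Finset.card_erase_add_one hj])
  · rfl

theorem delRΩ_single_empty (u : Fin n → R) (r : R) :
    delRΩ u (Pi.single (∅ : Finset (Fin n)) r) = 0 := by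
  funext J
  rw [delRΩ_apply]
  simp

theorem delRΩ_apply_empty_mem (u : Fin n → R) (f : RΩ R n) :
    delRΩ u f ∅ ∈ Ideal.span (Set.range u) := by
  rw [delRΩ_apply_empty]
  exact Ideal.sum_mem _ fun i _ => Ideal.mul_mem_right _ _ (Ideal.subset_span ⟨i, rfl⟩)

theorem delRΩ_delRΩ_apply_empty (u : Fin n → R) (f : RΩ R n) :
    delRΩ u (delRΩ u f) ∅ = 0 := by
  simp only [delRΩ_apply_empty, delRΩ_apply u f, Finset.mul_sum]
  refine sum_sum_eq_zero_of_antisymm _ (fun i j => ?_) (fun i => by simp)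
  by_cases hij : i = j
  · simp [hij]
  · have hs : ∀ k l : Fin n, ksign R k {l} = if l < k then -1 else 1 := fun k l => by
      rw [← insert_empty_eq, ksign_insert (Finset.notMem_empty l)]
      simp [ksign]
    simp only [Finset.mem_singleton, hij, Ne.symm hij, if_false, hs, Finset.pair_comm i j]
    rcases lt_or_gt_of_ne hij with h | h <;> simp only [h, h.not_gt, if_true, if_false] <;>
      ring

theorem exists_linearMap_quotient_mk {M : Type*} [AddCommGroup M] [Module S M] (I : Ideal R)
    (D : R →ₗ[S] M) (hD : I.restrictScalars S ≤ LinearMap.ker D) :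
    ∃ σ : (R ⧸ I) →ₗ[S] M, ∀ r, σ (Ideal.Quotient.mk I r) = D r :=
  ⟨(Submodule.liftQ _ D hD) ∘ₗ
    (Submodule.Quotient.restrictScalarsEquiv S I).symm.toLinearMap, fun _ => rfl⟩

section contraction

variable {u : Fin n → R} {dd : Fin n → (R →ₗ[S] R)} {H : RΩ R n →ₗ[S] RΩ R n}

/-- Under injectivity of `p + δ∇⁰` in positive degrees `p`, a contraction `H` with `τH = ∇`
vanishes wherever `∇` does. -/
theorem contraction_apply_eq_zero
    (hinj : ∀ p : ℕ, 0 < p →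
      Function.Injective (p • (LinearMap.id : R →ₗ[S] R) + delNabla0 u dd))
    (hH : ∀ f, H f ∅ = 0)
    (hτ : ∀ f (J : Finset (Fin n)),
      (J.card • (LinearMap.id : R →ₗ[S] R) + delNabla0 u dd) (H f J) = nablaRΩ dd f J)
    {f : RΩ R n} {J : Finset (Fin n)} (hf : nablaRΩ dd f J = 0) : H f J = 0 := by
  rcases J.eq_empty_or_nonempty with rfl | hJ
  · exact hH f
  · exact hinj _ hJ.card_pos (by rw [hτ, hf, map_zero])

theorem contraction_homotopy
    (hleib : ∀ i j r, dd j (u i * r) = u i * dd j r + (if i = j then r else 0))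
    (hinj : ∀ p : ℕ, 0 < p →
      Function.Injective (p • (LinearMap.id : R →ₗ[S] R) + delNabla0 u dd))
    (hτ : ∀ f (J : Finset (Fin n)),
      (J.card • (LinearMap.id : R →ₗ[S] R) + delNabla0 u dd) (H f J) = nablaRΩ dd f J)
    (f : RΩ R n) {J : Finset (Fin n)} (hJ : J.Nonempty) :
    H (delRΩ u f) J + delRΩ u (H f) J = f J := by
  apply hinj _ hJ.card_pos
  rw [map_add, hτ, lie_delRΩ_apply hleib, funext (hτ f), add_comm,
    delRΩ_nablaRΩ_add_apply hleib]

theorem contraction_contraction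
    (hleib : ∀ i j r, dd j (u i * r) = u i * dd j r + (if i = j then r else 0))
    (hflat : ∀ i j, dd i ∘ₗ dd j = dd j ∘ₗ dd i)
    (hinj : ∀ p : ℕ, 0 < p →
      Function.Injective (p • (LinearMap.id : R →ₗ[S] R) + delNabla0 u dd))
    (hH : ∀ f, H f ∅ = 0)
    (hτ : ∀ f (J : Finset (Fin n)),
      (J.card • (LinearMap.id : R →ₗ[S] R) + delNabla0 u dd) (H f J) = nablaRΩ dd f J)
    (f : RΩ R n) : H (H f) = 0 := by
  funext J
  rcases J.eq_empty_or_nonempty with rfl | hJ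
  · exact hH _
  · apply hinj _ hJ.card_pos
    apply hinj _ hJ.card_pos
    rw [hτ, lie_nablaRΩ_apply hleib hflat, funext (hτ f), nablaRΩ_nablaRΩ hflat]
    simp

theorem contraction_apply_of_card_ne
    (hinj : ∀ p : ℕ, 0 < p →
      Function.Injective (p • (LinearMap.id : R →ₗ[S] R) + delNabla0 u dd))
    (hH : ∀ f, H f ∅ = 0)
    (hτ : ∀ f (J : Finset (Fin n)),
      (J.card • (LinearMap.id : R →ₗ[S] R) + delNabla0 u dd) (H f J) = nablaRΩ dd f J)
    {f : RΩ R n} {k : ℕ} (hf : ∀ I : Finset (Fin n), I.card ≠ k → f I = 0)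
    {J : Finset (Fin n)} (hJ : J.card ≠ k + 1) : H f J = 0 :=
  contraction_apply_eq_zero hinj hH hτ (nablaRΩ_eq_zero hf hJ)

/-- The degree-zero part of `δH` only depends on the degree-zero part of its argument. -/
theorem delRΩ_contraction_apply_empty
    (hinj : ∀ p : ℕ, 0 < p →
      Function.Injective (p • (LinearMap.id : R →ₗ[S] R) + delNabla0 u dd))
    (hH : ∀ f, H f ∅ = 0)
    (hτ : ∀ f (J : Finset (Fin n)),
      (J.card • (LinearMap.id : R →ₗ[S] R) + delNabla0 u dd) (H f J) = nablaRΩ dd f J)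
    (f : RΩ R n) :
    delRΩ u (H f) ∅ = delRΩ u (H (Pi.single (∅ : Finset (Fin n)) (f ∅))) ∅ := by
  rw [delRΩ_apply_empty, delRΩ_apply_empty]
  refine Finset.sum_congr rfl fun i _ => ?_
  rw [← sub_eq_zero, ← mul_sub, ← Pi.sub_apply, ← map_sub,
    contraction_apply_eq_zero hinj hH hτ, mul_zero]
  rw [nablaRΩ_apply_singleton]
  simp

/-- `δH` is concentrated in degree zero on degree-zero elements. -/
theorem delRΩ_contraction_single
    (hleib : ∀ i j r, dd j (u i * r) = u i * dd j r + (if i = j then r else 0))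
    (hinj : ∀ p : ℕ, 0 < p →
      Function.Injective (p • (LinearMap.id : R →ₗ[S] R) + delNabla0 u dd))
    (hτ : ∀ f (J : Finset (Fin n)),
      (J.card • (LinearMap.id : R →ₗ[S] R) + delNabla0 u dd) (H f J) = nablaRΩ dd f J)
    (r : R) {J : Finset (Fin n)} (hJ : J.Nonempty) :
    delRΩ u (H (Pi.single (∅ : Finset (Fin n)) r)) J = 0 := by
  have h := contraction_homotopy hleib hinj hτ (Pi.single (∅ : Finset (Fin n)) r) hJ
  rw [delRΩ_single_empty, map_zero, Pi.zero_apply, zero_add] at h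
  rw [h, Pi.single_eq_of_ne hJ.ne_empty]

theorem contraction_homotopy_of_card_ne_zero
    (hleib : ∀ i j r, dd j (u i * r) = u i * dd j r + (if i = j then r else 0))
    (hinj : ∀ p : ℕ, 0 < p →
      Function.Injective (p • (LinearMap.id : R →ₗ[S] R) + delNabla0 u dd))
    (hH : ∀ f, H f ∅ = 0)
    (hτ : ∀ f (J : Finset (Fin n)),
      (J.card • (LinearMap.id : R →ₗ[S] R) + delNabla0 u dd) (H f J) = nablaRΩ dd f J)
    {f : RΩ R n} (hf : f ∅ = 0) :
    H (delRΩ u f) + delRΩ u (H f) = f := by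
  funext J
  rcases J.eq_empty_or_nonempty with rfl | hJ
  · rw [Pi.add_apply, hH, delRΩ_contraction_apply_empty hinj hH hτ, hf]
    simp
  · exact contraction_homotopy hleib hinj hτ f hJ

theorem delRΩ_contraction_single_of_mem
    (hleib : ∀ i j r, dd j (u i * r) = u i * dd j r + (if i = j then r else 0))
    (hinj : ∀ p : ℕ, 0 < p →
      Function.Injective (p • (LinearMap.id : R →ₗ[S] R) + delNabla0 u dd))
    (hH : ∀ f, H f ∅ = 0)
    (hτ : ∀ f (J : Finset (Fin n)),
      (J.card • (LinearMap.id : R →ₗ[S] R) + delNabla0 u dd) (H f J) = nablaRΩ dd f J)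
    {r : R} (hr : r ∈ Ideal.span (Set.range u)) :
    delRΩ u (H (Pi.single (∅ : Finset (Fin n)) r)) ∅ = r := by
  obtain ⟨c, rfl⟩ := Ideal.mem_span_range_iff_exists_fun.1 hr
  let ω : RΩ R n := fun I => ∑ i, if I = {i} then c i else 0
  have hω : delRΩ u ω ∅ = ∑ i, c i * u i := by
    simp [delRΩ_apply_empty, ω, mul_comm]
  have h := contraction_homotopy_of_card_ne_zero hleib hinj hH hτ
    (f := ω) (by simp [ω, eq_comm (a := (∅ : Finset (Fin n)))])
  have h2 : H (delRΩ u ω) = ω - delRΩ u (H ω) := eq_sub_of_add_eq h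
  rw [← hω, ← delRΩ_contraction_apply_empty hinj hH hτ, h2, map_sub, Pi.sub_apply,
    delRΩ_delRΩ_apply_empty, sub_zero]

end contraction

end deRham

end Stmt7

open Stmt7 in
theorem statement7
    {S R : Type*} [CommRing S] [CommRing R] [Algebra S R] {n : ℕ}
    -- a quasi-regular sequence t = (t₁,…,tₙ) in R …
    (u : Fin n → R) (hqreg : IsQuasiRegular u)
    -- … such that R/tR is a finitely generated projective S-module
    (hfin : Module.Finite S (R ⧸ Ideal.span (Set.range u)))
    (hproj : Module.Projective S (R ⧸ Ideal.span (Set.range u)))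
    -- a flat S-linear connection (components ∂ⱼ, Leibniz over S[t], flat) …
    (dd : Fin n → (R →ₗ[S] R))
    (hleib : ∀ i j r, dd j (u i * r) = u i * dd j r + (if i = j then r else 0))
    (hflat : ∀ i j, dd i ∘ₗ dd j = dd j ∘ₗ dd i)
    -- … which is standard …
    (hstd_bij : ∀ p : ℕ, 0 < p →
      Function.Bijective (p • (LinearMap.id : R →ₗ[S] R) + delNabla0 u dd))
    (hstd_ideal : ∀ p : ℕ, 0 < p →
      Submodule.map (p • (LinearMap.id : R →ₗ[S] R) + delNabla0 u dd)
        ((Ideal.span (Set.range u)).restrictScalars S) =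
        (Ideal.span (Set.range u)).restrictScalars S)
    (hstd_im : LinearMap.range (delNabla0 u dd) =
      (Ideal.span (Set.range u)).restrictScalars S)
    -- … and satisfies Ker(∇⁰) + tR = R
    (hker : (⨅ j, LinearMap.ker (dd j)) ⊔
      (Ideal.span (Set.range u)).restrictScalars S = ⊤) :
    -- write δ for the (S-linear restriction of the) Koszul differential,
    -- τ = δ∇ + ∇δ, and let H = τ⁻¹∇ be the de Rham contraction, characterised by
    -- τ ∘ H = ∇ together with H having no component in exterior degree 0:
    ∀ H : RΩ R n →ₗ[S] RΩ R n,
      (∀ f, H f ∅ = 0) →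
      ((delRΩ u).restrictScalars S ∘ₗ nablaRΩ dd +
          nablaRΩ dd ∘ₗ (delRΩ u).restrictScalars S) ∘ₗ H = nablaRΩ dd →
    -- (i)  (Hδ + δH)(ω) = ω for homogeneous ω of nonzero degree
    ((∀ (kk : ℕ) (f : RΩ R n), kk ≠ 0 → (∀ I, I.card ≠ kk → f I = 0) →
        H ((delRΩ u).restrictScalars S f) + (delRΩ u).restrictScalars S (H f) = f) ∧
    -- (ii) (1 − δH)(tR) = 0 in degree zero
    (∀ r ∈ Ideal.span (Set.range u),
        (delRΩ u).restrictScalars S (H (Pi.single (∅ : Finset (Fin n)) r)) =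
          Pi.single (∅ : Finset (Fin n)) r) ∧
    -- (iii) H² = 0
    (H ∘ₗ H = 0) ∧
    -- (H has degree −1, i.e. raises exterior degree by one)
    (∀ (kk : ℕ) (f : RΩ R n), (∀ I, I.card ≠ kk → f I = 0) →
        ∀ J, J.card ≠ kk + 1 → H f J = 0) ∧
    -- (iv) there is a unique S-linear σ : R/tR → R with δH + σπ = 1 …
    (∃! σ : (R ⧸ Ideal.span (Set.range u)) →ₗ[S] R,
      ∀ r : R,
        ((delRΩ u).restrictScalars S (H (Pi.single (∅ : Finset (Fin n)) r))) ∅ +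
          σ (Ideal.Quotient.mk (Ideal.span (Set.range u)) r) = r) ∧
    -- … and for this σ one has ∇⁰σ = 0, and (π, σ, −H) is a deformation retract
    -- datum contracting the Koszul complex onto R/tR, with Hσ = 0 and πH = 0.
    (∀ σ : (R ⧸ Ideal.span (Set.range u)) →ₗ[S] R,
      (∀ r : R,
        ((delRΩ u).restrictScalars S (H (Pi.single (∅ : Finset (Fin n)) r))) ∅ +
          σ (Ideal.Quotient.mk (Ideal.span (Set.range u)) r) = r) →
      -- ∇⁰ σ = 0
      (∀ x j, dd j (σ x) = 0) ∧
      -- π σ = 1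
      (∀ x, Ideal.Quotient.mk (Ideal.span (Set.range u)) (σ x) = x) ∧
      -- σ π = 1 + δ(−H) + (−H)δ on the Koszul complex
      (((LinearMap.single R (fun _ : Finset (Fin n) => R) ∅).restrictScalars S ∘ₗ σ) ∘ₗ
          ((Submodule.mkQ (Ideal.span (Set.range u))) ∘ₗ
            (LinearMap.proj (∅ : Finset (Fin n)) :
              RΩ R n →ₗ[R] R)).restrictScalars S =
        LinearMap.id -
          ((delRΩ u).restrictScalars S ∘ₗ H + H ∘ₗ (delRΩ u).restrictScalars S)) ∧
      -- H σ = 0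
      (H ∘ₗ ((LinearMap.single R (fun _ : Finset (Fin n) => R) ∅).restrictScalars S ∘ₗ σ)
          = 0) ∧
      -- π H = 0
      (((Submodule.mkQ (Ideal.span (Set.range u))) ∘ₗ
          (LinearMap.proj (∅ : Finset (Fin n)) :
            RΩ R n →ₗ[R] R)).restrictScalars S ∘ₗ H = 0))) := by
  intro H hH hτ'
  have hinj : ∀ p : ℕ, 0 < p →
      Function.Injective (p • (LinearMap.id : R →ₗ[S] R) + delNabla0 u dd) :=
    fun p hp => (hstd_bij p hp).1
  have hτ : ∀ f (J : Finset (Fin n)),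
      (J.card • (LinearMap.id : R →ₗ[S] R) + delNabla0 u dd) (H f J) = nablaRΩ dd f J :=
    fun f J => by
      rw [← delRΩ_nablaRΩ_add_apply hleib]
      exact congrFun (LinearMap.congr_fun hτ' f) J
  have hsingle : ∀ r, r ∈ Ideal.span (Set.range u) →
      delRΩ u (H (Pi.single (∅ : Finset (Fin n)) r)) ∅ = r :=
    fun r hr => delRΩ_contraction_single_of_mem hleib hinj hH hτ hr
  have hHker : ∀ r, (∀ j, dd j r = 0) → H (Pi.single (∅ : Finset (Fin n)) r) = 0 := by
    intro r hr
    funext J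
    refine contraction_apply_eq_zero hinj hH hτ ?_
    rw [nablaRΩ_apply]
    refine Finset.sum_eq_zero fun j _ => ?_
    by_cases hJ : J.erase j = ∅
    · simp [hJ, hr]
    · simp [Pi.single_eq_of_ne hJ]
  refine ⟨fun k f hk hf => ?_, fun r hr => ?_, ?_, fun k f hf J hJ => ?_, ?_, fun σ hσ => ?_⟩
  · exact contraction_homotopy_of_card_ne_zero hleib hinj hH hτ (hf ∅ (by simpa using hk.symm))
  · funext J
    rcases J.eq_empty_or_nonempty with rfl | hJ
    · simpa using hsingle r hr
    · rw [Pi.single_eq_of_ne hJ.ne_empty]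
      exact delRΩ_contraction_single hleib hinj hτ r hJ
  · exact LinearMap.ext fun f => contraction_contraction hleib hflat hinj hH hτ f
  · exact contraction_apply_of_card_ne hinj hH hτ hf hJ
  · let D : R →ₗ[S] R := LinearMap.id - LinearMap.proj ∅ ∘ₗ (delRΩ u).restrictScalars S ∘ₗ H ∘ₗ
      (LinearMap.single R (fun _ : Finset (Fin n) => R) ∅).restrictScalars S
    have hD : (Ideal.span (Set.range u)).restrictScalars S ≤ LinearMap.ker D := fun r hr => by
      rw [LinearMap.mem_ker]
      exact sub_eq_zero.2 (hsingle r hr).symm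
    obtain ⟨σ, hσ⟩ := exists_linearMap_quotient_mk _ D hD
    have hD' : ∀ r, D r = r - delRΩ u (H (Pi.single (∅ : Finset (Fin n)) r)) ∅ := fun _ => rfl
    refine ⟨σ, fun r => ?_, fun σ' hσ' => LinearMap.ext fun x => ?_⟩
    · rw [hσ, hD']
      exact add_sub_cancel _ r
    · obtain ⟨r, rfl⟩ := Ideal.Quotient.mk_surjective x
      rw [hσ, hD']
      exact eq_sub_of_add_eq' (hσ' r)
  · have hσ' : ∀ r, σ (Ideal.Quotient.mk (Ideal.span (Set.range u)) r) =
        r - delRΩ u (H (Pi.single (∅ : Finset (Fin n)) r)) ∅ := fun r => eq_sub_of_add_eq' (hσ r)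
    have hflatσ : ∀ x j, dd j (σ x) = 0 := by
      intro x j
      obtain ⟨r, rfl⟩ := Ideal.Quotient.mk_surjective x
      obtain ⟨a, ha, b, hb, rfl⟩ := Submodule.mem_sup.1 (hker ▸ Submodule.mem_top (x := r))
      have ha' : ∀ j, dd j a = 0 := fun j => (Submodule.mem_iInf _).1 ha j
      have hb' : Ideal.Quotient.mk (Ideal.span (Set.range u)) b = 0 :=
        Ideal.Quotient.eq_zero_iff_mem.2 hb
      rw [map_add, hb', add_zero, hσ', hHker a ha', map_zero, Pi.zero_apply, sub_zero, ha']
    refine ⟨hflatσ, fun x => ?_, ?_, ?_, ?_⟩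
    · obtain ⟨r, rfl⟩ := Ideal.Quotient.mk_surjective x
      rw [hσ', map_sub, Ideal.Quotient.eq_zero_iff_mem.2 (delRΩ_apply_empty_mem u _), sub_zero]
    · refine LinearMap.ext fun f => funext fun J => ?_
      change (Pi.single (∅ : Finset (Fin n))
          (σ (Ideal.Quotient.mk (Ideal.span (Set.range u)) (f ∅))) : RΩ R n) J =
        f J - (delRΩ u (H f) J + H (delRΩ u f) J)
      rcases J.eq_empty_or_nonempty with rfl | hJ
      · rw [Pi.single_eq_same, hσ', hH, add_zero, ← delRΩ_contraction_apply_empty hinj hH hτ]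
      · rw [Pi.single_eq_of_ne hJ.ne_empty, add_comm, contraction_homotopy hleib hinj hτ f hJ,
          sub_self]
    · exact LinearMap.ext fun x => hHker (σ x) (hflatσ x)
    · refine LinearMap.ext fun f => ?_
      change Ideal.Quotient.mk (Ideal.span (Set.range u)) (H f ∅) = 0
      rw [hH, map_zero]
end

section
/- Let φ: S → R be a ring morphism, t = (t₁,…,tₙ) a quasi-regular sequence in R with R/tR finitely generated projective over S, and ∇⁰: R → R⊗_{S[t]}Ω¹_{S[t]/S} a flat S-linear connection with Ker(∇⁰) + tR = R. Then for all s, r₁,…,rₙ ∈ R, the residue symbol satisfies Res_{R/S}[s·dr₁⋯drₙ / t₁,…,tₙ] = Σ_{τ∈Sₙ} sgn(τ)·tr_S( s·[∂/∂t_{τ(1)}, r₁]⋯[∂/∂t_{τ(n)}, rₙ] ), where ∂/∂tⱼ = (dtⱼ)*∘∇⁰, each commutator [∂/∂tⱼ, r] (r acting by multiplication) is S[t]-linear on R and hence induces an S-linear endomorphism of R/tR, and the traces are of S-linear endomorphisms of R/tR. -/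
/-!
STATEMENT 8 (the residue symbol via the connection equals the Sₙ-sum of traces).

Conventions.  `S[t] = S[t₁,…,tₙ]` maps to `R` by `tᵢ ↦ u i`; `R ⊗_{S[t]} Ω_{S[t]/S}` is
modelled as `Finset (Fin n) → R` (`R·dt_I` at `I`), with Koszul contraction `δ` and the
degree `-1` extension `∇` of the connection; the connection is encoded by its components
`∂ j = (dtⱼ)* ∘ ∇⁰ : R →ₗ[S] R` (Leibniz over `S[t]` ⟺ `∂ⱼ(uᵢ r) = uᵢ∂ⱼr + δᵢⱼ r`;
flat ⟺ the `∂ⱼ` commute).  Multiplication by `a ∈ R` is `a • 1`.  The composite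
`s[∇,r₁]⋯[∇,rₙ]` has degree `-n`; trivialising `Ωⁿ` by `dt₁∧⋯∧dtₙ` it gives the map
`R → R`, `x ↦ (s[∇,r₁]⋯[∇,rₙ](x·dt_∅)) dt_{univ}`-coefficient, which is `S[t]`-linear
and so descends to an `S`-linear endomorphism `Tbar` of `R/tR` (the descended map is
unique since the quotient map is surjective; its existence is part of the statement).
The residue symbol `Res_{R/S}[s·dr₁⋯drₙ / t₁,…,tₙ]` is `tr_S(Tbar)`, and the claim is
that it equals `Σ_{τ∈Sₙ} sgn(τ)·tr_S(s̄ [∂_{τ(1)},r₁]⋯[∂_{τ(n)},rₙ])` with all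
operators descended to `R/tR`.  Quasi-regularity is the classical coefficient condition.
-/

namespace Stmt8

open Finset

def IsQuasiRegular {R : Type*} [CommRing R] {n : ℕ} (u : Fin n → R) : Prop :=
  ∀ (k : ℕ) (F : MvPolynomial (Fin n) R), F.IsHomogeneous k →
    MvPolynomial.eval u F ∈ (Ideal.span (Set.range u)) ^ (k + 1) →
    ∀ m, MvPolynomial.coeff m F ∈ Ideal.span (Set.range u)

abbrev RΩ (R : Type*) (n : ℕ) := Finset (Fin n) → R

def ksign (R : Type*) [CommRing R] {n : ℕ} (i : Fin n) (I : Finset (Fin n)) : R :=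
  (-1 : R) ^ (I.filter (fun j => j < i)).card

def delRΩ {R : Type*} [CommRing R] {n : ℕ} (u : Fin n → R) : Module.End R (RΩ R n) :=
  LinearMap.pi fun J =>
    ∑ i : Fin n,
      if i ∈ J then 0
      else (ksign R i J * u i) • LinearMap.proj (insert i J)

def nablaRΩ {S R : Type*} [CommRing S] [CommRing R] [Algebra S R] {n : ℕ}
    (dd : Fin n → (R →ₗ[S] R)) : RΩ R n →ₗ[S] RΩ R n :=
  LinearMap.pi fun J =>
    ∑ j : Fin n,
      if j ∈ J then ksign R j J • (dd j ∘ₗ LinearMap.proj (J.erase j)) else 0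

/-- The commutator `[∇, a]` (with `a` acting by multiplication). -/
def commNabla {S R : Type*} [CommRing S] [CommRing R] [Algebra S R] {n : ℕ}
    (dd : Fin n → (R →ₗ[S] R)) (a : R) : Module.End S (RΩ R n) :=
  nablaRΩ dd ∘ₗ (a • (1 : Module.End R (RΩ R n))).restrictScalars S -
    (a • (1 : Module.End R (RΩ R n))).restrictScalars S ∘ₗ nablaRΩ dd

end Stmt8

namespace Stmt8

section Descent

variable {S R : Type*} [CommRing S] [CommRing R] [Algebra S R]

theorem exists_end_quotient (I : Ideal R) (f : Module.End S R) (hf : ∀ x ∈ I, f x ∈ I) :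
    ∃ g : Module.End S (R ⧸ I), ∀ x, g (Ideal.Quotient.mk I x) = Ideal.Quotient.mk I (f x) := by
  let e := Submodule.Quotient.restrictScalarsEquiv S I
  refine ⟨e.toLinearMap ∘ₗ
    (Submodule.mapQ (I.restrictScalars S) (I.restrictScalars S) f hf) ∘ₗ e.symm.toLinearMap, ?_⟩
  intro x
  rfl

theorem mk_list_prod_apply {ι : Type*} (I : Ideal R) (l : List ι) (c : ι → Module.End S R)
    (C : ι → Module.End S (R ⧸ I))
    (h : ∀ i x, C i (Ideal.Quotient.mk I x) = Ideal.Quotient.mk I (c i x)) (x : R) :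
    (l.map C).prod (Ideal.Quotient.mk I x) = Ideal.Quotient.mk I ((l.map c).prod x) := by
  induction l with
  | nil => simp
  | cons a l ih => simp [ih, h]

theorem map_mem_span_of_map_mul {ι : Type*} [Finite ι] (u : ι → R) (f : Module.End S R)
    (hf : ∀ i x, f (u i * x) = u i * f x) {x : R} (hx : x ∈ Ideal.span (Set.range u)) :
    f x ∈ Ideal.span (Set.range u) := by
  cases nonempty_fintype ι
  obtain ⟨a, rfl⟩ := (Ideal.mem_span_range_iff_exists_fun).1 hx
  rw [map_sum]
  refine Ideal.sum_mem _ fun i _ => ?_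
  rw [mul_comm, hf]
  exact Ideal.mul_mem_right _ _ (Ideal.subset_span ⟨i, rfl⟩)

end Descent

/-- The commutator `[d, a]` of an endomorphism with multiplication by `a`. -/
def mulCommutator {S R : Type*} [CommRing S] [CommRing R] [Algebra S R]
    (d : R →ₗ[S] R) (a : R) : Module.End S R :=
  d ∘ₗ LinearMap.mulLeft S a - LinearMap.mulLeft S a ∘ₗ d

section Koszul

variable {S R : Type*} [CommRing S] [CommRing R] [Algebra S R] {n : ℕ}

theorem mulCommutator_apply (d : R →ₗ[S] R) (a x : R) :
    mulCommutator d a x = d (a * x) - a * d x := rfl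

theorem mulCommutator_mul (u : Fin n → R) (dd : Fin n → (R →ₗ[S] R))
    (hleib : ∀ i j r, dd j (u i * r) = u i * dd j r + (if i = j then r else 0))
    (a : R) (i j : Fin n) (x : R) :
    mulCommutator (dd j) a (u i * x) = u i * mulCommutator (dd j) a x := by
  rw [mulCommutator_apply, mulCommutator_apply, mul_left_comm, hleib, hleib]
  split_ifs <;> ring

theorem commNabla_apply (dd : Fin n → (R →ₗ[S] R)) (a : R) (ω : RΩ R n)
    (J : Finset (Fin n)) :
    commNabla dd a ω J =
      ∑ j, if j ∈ J then ksign R j J * mulCommutator (dd j) a (ω (J.erase j)) else 0 := by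
  simp only [commNabla, nablaRΩ, LinearMap.sub_apply, LinearMap.comp_apply, Pi.sub_apply,
    LinearMap.pi_apply, LinearMap.sum_apply, LinearMap.coe_restrictScalars,
    LinearMap.smul_apply, Module.End.one_apply, Pi.smul_apply, smul_eq_mul]
  rw [Finset.mul_sum, ← Finset.sum_sub_distrib]
  refine Finset.sum_congr rfl fun j _ => ?_
  split_ifs
  · simp [mulCommutator_apply]
    ring
  · simp

theorem ksign_image {m : ℕ} (g : Fin m → Fin n) (hg : StrictMono g) (l : Fin m) :
    ksign R (g l) (Finset.univ.image g) = (-1) ^ (l : ℕ) := by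
  have h : (Finset.univ.image g).filter (fun j => j < g l) = (Finset.Iio l).image g := by
    ext j
    simp only [Finset.mem_filter, Finset.mem_image, Finset.mem_univ, true_and, Finset.mem_Iio]
    constructor
    · rintro ⟨⟨k, rfl⟩, hk⟩
      exact ⟨k, hg.lt_iff_lt.1 hk, rfl⟩
    · rintro ⟨k, hk, rfl⟩
      exact ⟨⟨k, rfl⟩, hg hk⟩
  rw [ksign, h, Finset.card_image_of_injective _ hg.injective, Fin.card_Iio]

theorem image_erase {m : ℕ} (g : Fin (m + 1) → Fin n) (hg : Function.Injective g)
    (l : Fin (m + 1)) :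
    (Finset.univ.image g).erase (g l) = Finset.univ.image (g ∘ l.succAbove) := by
  ext j
  simp only [Finset.mem_erase, Finset.mem_image, Finset.mem_univ, true_and, Function.comp_apply]
  constructor
  · rintro ⟨hj, k, rfl⟩
    obtain ⟨i, rfl⟩ := Fin.exists_succAbove_eq (x := k) (y := l) (fun h => hj (by rw [h]))
    exact ⟨i, rfl⟩
  · rintro ⟨i, rfl⟩
    exact ⟨fun h => Fin.succAbove_ne l i (hg h), _, rfl⟩

/-- The matrix whose determinant is the coefficient of `dt_{g 0} ∧ ⋯ ∧ dt_{g (m-1)}` in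
`dt_{f 0} ∧ ⋯ ∧ dt_{f (m-1)}`. -/
def incidence {m : ℕ} (f g : Fin m → Fin n) : Matrix (Fin m) (Fin m) ℤ :=
  Matrix.of fun k l => if f k = g l then 1 else 0

theorem det_incidence_cons {m : ℕ} (j : Fin n) (f : Fin m → Fin n) (g : Fin (m + 1) → Fin n) :
    (incidence (Fin.cons j f : Fin (m + 1) → Fin n) g).det =
      ∑ l : Fin (m + 1), if j = g l then
        (-1) ^ (l : ℕ) * (incidence f (g ∘ l.succAbove)).det else 0 := by
  rw [Matrix.det_succ_row_zero]
  refine Finset.sum_congr rfl fun l _ => ?_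
  have h : (incidence (Fin.cons j f : Fin (m + 1) → Fin n) g).submatrix Fin.succ l.succAbove =
      incidence f (g ∘ l.succAbove) := by
    ext a b
    simp [incidence]
  rw [h]
  simp [incidence]

theorem prod_commNabla_single_apply (dd : Fin n → (R →ₗ[S] R)) (x : R) {m : ℕ} :
    ∀ (r : Fin m → R) (g : Fin m → Fin n), StrictMono g →
    (List.ofFn fun k => commNabla dd (r k)).prod (Pi.single ∅ x) (Finset.univ.image g) =
      ∑ f : Fin m → Fin n, (incidence f g).det •
        (List.ofFn fun k => mulCommutator (dd (f k)) (r k)).prod x := by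
  induction m with
  | zero =>
    intro r g _
    simp [incidence]
  | succ m ih =>
    intro r g hg
    rw [List.ofFn_succ, List.prod_cons, Module.End.mul_apply, commNabla_apply,
      ← (Fin.consEquiv fun _ : Fin (m + 1) => Fin n).sum_comp, Fintype.sum_prod_type,
      ← Finset.sum_filter]
    have hfil : Finset.univ.filter (fun j => j ∈ Finset.univ.image g) = Finset.univ.image g := by
      simp
    rw [hfil, Finset.sum_image (hg.injective.injOn)]
    have hcons : ∀ p : Fin n × (Fin m → Fin n),
        (Fin.consEquiv fun _ : Fin (m + 1) => Fin n) p = Fin.cons p.1 p.2 := fun _ => rfl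
    simp only [hcons, det_incidence_cons, Finset.sum_smul, ite_smul, zero_smul,
      List.ofFn_succ, Fin.cons_zero, Fin.cons_succ, List.prod_cons, Module.End.mul_apply]
    rw [Finset.sum_congr rfl fun j _ => Finset.sum_comm, Finset.sum_comm]
    refine Finset.sum_congr rfl fun l _ => ?_
    rw [Finset.sum_eq_single (g l) (by intro j _ hj; simp [hj]) (by simp),
      ksign_image g hg, image_erase g hg.injective,
      ih (fun k => r k.succ) _ (hg.comp (Fin.strictMono_succAbove l)), map_sum, Finset.mul_sum]
    refine Finset.sum_congr rfl fun f _ => ?_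
    rw [if_pos rfl, map_zsmul, mul_smul]
    simp [zsmul_eq_mul]

theorem prod_commNabla_single_univ (dd : Fin n → (R →ₗ[S] R)) (r : Fin n → R) (x : R) :
    (List.ofFn fun k => commNabla dd (r k)).prod (Pi.single ∅ x) Finset.univ =
      ∑ τ : Equiv.Perm (Fin n), (Equiv.Perm.sign τ : ℤ) •
        (List.ofFn fun k => mulCommutator (dd (τ k)) (r k)).prod x := by
  have h := prod_commNabla_single_apply dd x r id strictMono_id
  rw [Finset.image_id] at h
  rw [h]
  symm
  refine Finset.sum_of_injOn (fun τ : Equiv.Perm (Fin n) => (τ : Fin n → Fin n))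
    DFunLike.coe_injective.injOn (by simp) ?_ ?_
  · intro f _ hf
    have hinj : ¬ Function.Injective f := fun hinj => hf
      ⟨Equiv.ofBijective f (Finite.injective_iff_bijective.1 hinj), by simp, rfl⟩
    simp only [Function.Injective, not_forall] at hinj
    obtain ⟨a, b, hab, hne⟩ := hinj
    rw [Matrix.det_zero_of_row_eq hne (by ext l; simp [incidence, hab]), zero_smul]
  · intro τ _
    have hdet : incidence (τ : Fin n → Fin n) id = (1 : Matrix _ _ ℤ).submatrix τ id := by
      ext a b
      simp [incidence, Matrix.one_apply]
    rw [hdet, Matrix.det_permute]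
    simp

end Koszul

end Stmt8

open Stmt8 in
theorem statement8
    {S R : Type*} [CommRing S] [CommRing R] [Algebra S R] {n : ℕ}
    -- a quasi-regular sequence with R/tR finitely generated projective over S
    (u : Fin n → R) (hqreg : IsQuasiRegular u)
    (hfin : Module.Finite S (R ⧸ Ideal.span (Set.range u)))
    (hproj : Module.Projective S (R ⧸ Ideal.span (Set.range u)))
    -- a flat S-linear connection with Ker(∇⁰) + tR = R
    (dd : Fin n → (R →ₗ[S] R))
    (hleib : ∀ i j r, dd j (u i * r) = u i * dd j r + (if i = j then r else 0))
    (hflat : ∀ i j, dd i ∘ₗ dd j = dd j ∘ₗ dd i)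
    (hker : (⨅ j, LinearMap.ker (dd j)) ⊔
      (Ideal.span (Set.range u)).restrictScalars S = ⊤)
    -- the data of the residue symbol
    (s : R) (r : Fin n → R) :
    -- the endomorphism s[∇,r₁]⋯[∇,rₙ] of R ⊗ Ω, trivialised by dt₁∧⋯∧dtₙ,
    -- as the S-linear map R → R:
    let T : Module.End S (RΩ R n) :=
      (s • (1 : Module.End R (RΩ R n))).restrictScalars S *
        ((List.ofFn fun kk => commNabla dd (r kk)).prod)
    let Topr : R →ₗ[S] R :=
      (LinearMap.proj (Finset.univ : Finset (Fin n)) : RΩ R n →ₗ[R] R).restrictScalars S ∘ₗ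
        T ∘ₗ
        (LinearMap.single R (fun _ : Finset (Fin n) => R) ∅).restrictScalars S
    -- it descends to R/tR, multiplication by s and the commutators [∂ⱼ, rᵢ] descend
    -- to R/tR, and the residue symbol (= the trace of the descended operator)
    -- satisfies the asserted Sₙ-formula:
    ∃ (Tbar : Module.End S (R ⧸ Ideal.span (Set.range u)))
      (sbar : Module.End S (R ⧸ Ideal.span (Set.range u)))
      (C : Fin n → Fin n → Module.End S (R ⧸ Ideal.span (Set.range u))),
      (∀ x : R, Tbar (Ideal.Quotient.mk (Ideal.span (Set.range u)) x) =
        Ideal.Quotient.mk (Ideal.span (Set.range u)) (Topr x)) ∧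
      (∀ x : R, sbar (Ideal.Quotient.mk (Ideal.span (Set.range u)) x) =
        Ideal.Quotient.mk (Ideal.span (Set.range u)) (s * x)) ∧
      (∀ (j i : Fin n) (x : R),
        C j i (Ideal.Quotient.mk (Ideal.span (Set.range u)) x) =
          Ideal.Quotient.mk (Ideal.span (Set.range u))
            (dd j (r i * x) - r i * dd j x)) ∧
      LinearMap.trace S _ Tbar =
        ∑ τ : Equiv.Perm (Fin n),
          (Equiv.Perm.sign τ : ℤ) •
            LinearMap.trace S _ (sbar * (List.ofFn fun kk => C (τ kk) kk).prod) := by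
  intro T Topr
  have hC : ∀ p : Fin n × Fin n, ∃ g : Module.End S (R ⧸ Ideal.span (Set.range u)),
      ∀ x, g (Ideal.Quotient.mk _ x) =
        Ideal.Quotient.mk _ (mulCommutator (dd p.1) (r p.2) x) := fun p =>
    exists_end_quotient _ _ fun _ hx =>
      map_mem_span_of_map_mul u _ (fun i x => mulCommutator_mul u dd hleib _ i p.1 x) hx
  choose C hC using hC
  obtain ⟨sbar, hs⟩ := exists_end_quotient (S := S) (Ideal.span (Set.range u))
    (LinearMap.mulLeft S s) fun x hx => Ideal.mul_mem_left _ _ hx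
  refine ⟨∑ τ : Equiv.Perm (Fin n), (Equiv.Perm.sign τ : ℤ) •
    (sbar * (List.ofFn fun kk => C (τ kk, kk)).prod), sbar, fun j i => C (j, i), ?_, hs,
    fun j i x => hC (j, i) x, ?_⟩
  · intro x
    have hT : Topr x = s * ((List.ofFn fun kk => commNabla dd (r kk)).prod
        (Pi.single ∅ x) Finset.univ) := rfl
    rw [hT, prod_commNabla_single_univ, Finset.mul_sum, map_sum, LinearMap.sum_apply]
    refine Finset.sum_congr rfl fun τ _ => ?_
    have hp := mk_list_prod_apply (Ideal.span (Set.range u)) (List.finRange n)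
      (fun k => mulCommutator (dd (τ k)) (r k)) (fun k => C (τ k, k)) (fun k => hC (τ k, k)) x
    rw [← List.ofFn_eq_map, ← List.ofFn_eq_map] at hp
    rw [LinearMap.smul_apply, Module.End.mul_apply, hp, hs, mul_smul_comm, map_zsmul]
    rfl
  · simp only [map_sum, map_zsmul]
end

section
/- Let φ: S → R be a ring morphism, W ∈ S, and (X,d) a linear factorisation of φ(W) over R admitting an S-linear connection ∇⁰: X → X⊗_RΩ¹_{R/S}. Give X⊗_RΩ¹_{R/S} the differential d⊗1. Then the commutator [d,∇⁰] = d∘∇⁰ − ∇⁰∘d (where d also denotes d⊗1 on the target) is: (i) R-linear; (ii) a morphism of linear factorisations X → (X⊗_RΩ¹_{R/S})[1], i.e. it anticommutes with the differentials: (d⊗1)∘[d,∇⁰] = −[d,∇⁰]∘d; and (iii) independent of the choice of connection up to homotopy: for any two S-linear connections ∇⁰, ∇'⁰ on X, the difference [d,∇⁰] − [d,∇'⁰] is null-homotopic. -/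
/-!
STATEMENT 9 (basic properties of the Atiyah class).

Conventions.  A ℤ/2-graded `R`-module is encoded by a grading involution `g`; odd maps
anticommute with `g`, even maps commute, and a linear factorisation of `φ(W)` is an odd
`d` with `d² = φ(W)·1`.  `Ω¹_{R/S}` is `KaehlerDifferential S R` and the target
`X ⊗_R Ω¹_{R/S}` carries the differential `d ⊗ 1` and grading `g ⊗ 1`.  An `S`-linear
connection is a degree-zero `S`-linear map `∇⁰ : X → X ⊗_R Ω¹` satisfying the Leibniz
rule.  A morphism into the suspension `(X ⊗ Ω¹)[1]` is an odd map anticommuting with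
the differentials, and such a map is null-homotopic when it is of the form
`(d⊗1) ∘ h - h ∘ d` for an even map `h`.
-/

theorem statement9
    {S R : Type*} [CommRing S] [CommRing R] [Algebra S R] (W : S)
    {X : Type*} [AddCommGroup X] [Module R X] [Module S X] [IsScalarTower S R X]
    -- (X, d) a linear factorisation of φ(W) over R
    (g d : Module.End R X)
    (hg : g * g = 1)
    (hd_odd : d * g = -(g * d))
    (hd_sq : d * d = algebraMap S R W • (1 : Module.End R X))
    -- an S-linear connection ∇⁰ on X (degree zero, Leibniz rule)
    (nab : X →ₗ[S] TensorProduct R X (KaehlerDifferential S R))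
    (hnab_leibniz : ∀ (r : R) (x : X),
      nab (r • x) = r • nab x + x ⊗ₜ[R] (KaehlerDifferential.D S R r))
    (hnab_even :
      (LinearMap.rTensor (KaehlerDifferential S R) g).restrictScalars S ∘ₗ nab =
        nab ∘ₗ g.restrictScalars S) :
    -- the Atiyah class At_{R/S}(X) = [d, ∇⁰] = (d⊗1)∘∇⁰ − ∇⁰∘d
    let At : X →ₗ[S] TensorProduct R X (KaehlerDifferential S R) :=
      (LinearMap.rTensor (KaehlerDifferential S R) d).restrictScalars S ∘ₗ nab -
        nab ∘ₗ d.restrictScalars S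
    -- (i) At is R-linear:
    (∀ (r : R) (x : X), At (r • x) = r • At x) ∧
    -- (ii) At is a morphism X → (X ⊗ Ω¹)[1]: it is odd and anticommutes with the
    -- differentials:
    ((LinearMap.rTensor (KaehlerDifferential S R) g).restrictScalars S ∘ₗ At =
      -(At ∘ₗ g.restrictScalars S)) ∧
    ((LinearMap.rTensor (KaehlerDifferential S R) d).restrictScalars S ∘ₗ At =
      -(At ∘ₗ d.restrictScalars S)) ∧
    -- (iii) for any other S-linear connection ∇'⁰ the difference of the two Atiyah
    -- classes is null-homotopic:
    (∀ nab' : X →ₗ[S] TensorProduct R X (KaehlerDifferential S R),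
      (∀ (r : R) (x : X),
        nab' (r • x) = r • nab' x + x ⊗ₜ[R] (KaehlerDifferential.D S R r)) →
      ((LinearMap.rTensor (KaehlerDifferential S R) g).restrictScalars S ∘ₗ nab' =
        nab' ∘ₗ g.restrictScalars S) →
      ∃ hom : X →ₗ[R] TensorProduct R X (KaehlerDifferential S R),
        (LinearMap.rTensor (KaehlerDifferential S R) g ∘ₗ hom = hom ∘ₗ g) ∧
        At -
          ((LinearMap.rTensor (KaehlerDifferential S R) d).restrictScalars S ∘ₗ nab' -
            nab' ∘ₗ d.restrictScalars S) =
          (LinearMap.rTensor (KaehlerDifferential S R) d).restrictScalars S ∘ₗ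
              hom.restrictScalars S -
            hom.restrictScalars S ∘ₗ d.restrictScalars S) := by
  intro At
  have At_apply (x : X) :
      At x = LinearMap.rTensor (KaehlerDifferential S R) d (nab x) - nab (d x) := rfl
  have even_apply (x : X) :
      LinearMap.rTensor (KaehlerDifferential S R) g (nab x) = nab (g x) :=
    LinearMap.congr_fun hnab_even x
  have odd_apply (x : X) : d (g x) = -g (d x) := LinearMap.congr_fun hd_odd x
  have sq_apply (x : X) : d (d x) = W • x := by
    simpa using LinearMap.congr_fun hd_sq x
  have rTensor_sq_apply (t : TensorProduct R X (KaehlerDifferential S R)) :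
      LinearMap.rTensor (KaehlerDifferential S R) d
        (LinearMap.rTensor (KaehlerDifferential S R) d t) = W • t := by
    rw [← LinearMap.comp_apply, ← Module.End.mul_eq_comp, ← LinearMap.rTensor_mul, hd_sq,
      LinearMap.rTensor_smul, Module.End.one_eq_id, LinearMap.rTensor_id, LinearMap.smul_apply,
      LinearMap.id_apply, algebraMap_smul]
  have rTensor_odd_apply (t : TensorProduct R X (KaehlerDifferential S R)) :
      LinearMap.rTensor (KaehlerDifferential S R) g
        (LinearMap.rTensor (KaehlerDifferential S R) d t) =
      -LinearMap.rTensor (KaehlerDifferential S R) d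
        (LinearMap.rTensor (KaehlerDifferential S R) g t) := by
    have h := LinearMap.congr_fun
      (congrArg (LinearMap.rTensor (KaehlerDifferential S R)) hd_odd) t
    rw [LinearMap.rTensor_neg, LinearMap.rTensor_mul, LinearMap.rTensor_mul] at h
    exact (neg_eq_iff_eq_neg.mpr h).symm
  refine ⟨fun r x => ?_, ?_, ?_, fun nab' leibniz' even' => ?_⟩
  · simp only [At_apply, hnab_leibniz, map_add, map_smul, LinearMap.rTensor_tmul, smul_sub]
    abel
  · ext x
    change LinearMap.rTensor (KaehlerDifferential S R) g (At x) = -At (g x)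
    rw [At_apply, At_apply, map_sub, rTensor_odd_apply, even_apply, even_apply, odd_apply, map_neg]
    abel
  · ext x
    change LinearMap.rTensor (KaehlerDifferential S R) d (At x) = -At (d x)
    rw [At_apply, At_apply, map_sub, rTensor_sq_apply, sq_apply, map_smul]
    abel
  · let hom : X →ₗ[R] TensorProduct R X (KaehlerDifferential S R) :=
      { toFun := fun x => nab x - nab' x
        map_add' := fun x y => by rw [map_add, map_add]; abel
        map_smul' := fun r x => by
          rw [hnab_leibniz, leibniz', RingHom.id_apply, smul_sub]; abel }
    have hom_apply (x : X) : hom x = nab x - nab' x := rfl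
    refine ⟨hom, ?_, ?_⟩
    · refine LinearMap.ext fun x => ?_
      have even'_apply : LinearMap.rTensor (KaehlerDifferential S R) g (nab' x) = nab' (g x) :=
        LinearMap.congr_fun even' x
      rw [LinearMap.comp_apply, LinearMap.comp_apply, hom_apply, hom_apply, map_sub, even_apply,
        even'_apply]
    · refine LinearMap.ext fun x => ?_
      change At x - (LinearMap.rTensor (KaehlerDifferential S R) d (nab' x) - nab' (d x)) =
        LinearMap.rTensor (KaehlerDifferential S R) d (hom x) - hom (d x)
      rw [At_apply, hom_apply, hom_apply, map_sub]
      abel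
end
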